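/- For n ≥ 1, let H_n be the random variable 'total height' (sum over all vertices of the distance to the root) on the set of complete binary trees with 2n+1 vertices, equipped with the uniform distribution. Let μ(n) = E[H_n], m_i(n) = E[(H_n − μ(n))^i], and α_i(n) = m_i(n)/m_2(n)^{i/2}. Then lim_{n→∞} α_6(n) = (15/16016)·(−144144π³ − 720720π² + 3013725π + 2120320)/(10 − 3π)³ ≈ 27.685525695770609…. -/

import Mathlib

inductive PTree : Type
  | node : List PTree → PTree

namespace PTree

/-- Number of vertices of an ordered rooted (plane) tree. -/
def size : PTree → ℕ
  | node ts => 1 + (ts.attach.map fun t => size t.1).sum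
decreasing_by
  have := List.sizeOf_lt_of_mem t.2
  simp only [PTree.node.sizeOf_spec]
  omega

/-- Total height: sum over all vertices of the distance to the root. -/
def totalHeight : PTree → ℕ
  | node ts => (ts.attach.map fun t => totalHeight t.1 + size t.1).sum
decreasing_by
  have := List.sizeOf_lt_of_mem t.2
  simp only [PTree.node.sizeOf_spec]
  omega

/-- Every vertex has no children, or a number of children belonging to `S`. -/
def validDeg (S : Finset ℕ) : PTree → Prop
  | node ts => (ts = [] ∨ ts.length ∈ S) ∧ ∀ t ∈ ts, validDeg S t
decreasing_by
  have := List.sizeOf_lt_of_mem (by assumption : t ∈ ts)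
  simp only [PTree.node.sizeOf_spec]
  omega

end PTree

namespace TH

open Finset BinaryTree

/-- The plane tree associated with a binary tree. -/
def toP : BinaryTree Unit → PTree
  | .nil => .node []
  | .node _ l r => .node [toP l, toP r]

/-- Total height in terms of binary trees. -/
def ht : BinaryTree Unit → ℕ
  | .nil => 0
  | .node _ l r => ht l + ht r + 2 * (l.numNodes + r.numNodes + 1)

theorem size_toP (t : BinaryTree Unit) : (toP t).size = 2 * t.numNodes + 1 := by
  induction t with
  | nil => simp [toP, PTree.size, numNodes]
  | node a l r hl hr =>
    simp [toP, PTree.size, numNodes, hl, hr]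
    omega

theorem height_toP (t : BinaryTree Unit) : (toP t).totalHeight = ht t := by
  induction t with
  | nil => simp [toP, PTree.totalHeight, ht]
  | node a l r hl hr =>
    simp [toP, PTree.totalHeight, ht, hl, hr, size_toP]
    omega

theorem valid_toP (t : BinaryTree Unit) : (toP t).validDeg {2} := by
  induction t with
  | nil => simp [toP, PTree.validDeg]
  | node a l r hl hr =>
    rw [toP, PTree.validDeg]
    simp [hl, hr]

theorem toP_inj : Function.Injective toP := by
  intro s
  induction s with
  | nil =>
    intro t h
    cases t with
    | nil => rfl
    | node a l r => simp [toP] at h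
  | node a l r hl hr =>
    intro t h
    cases t with
    | nil => simp [toP] at h
    | node b l' r' =>
      simp only [toP, PTree.node.injEq, List.cons.injEq, and_true] at h
      rw [hl h.1, hr h.2]

theorem exists_toP : ∀ t : PTree, t.validDeg {2} → ∃ b, toP b = t
  | .node [], _ => ⟨.nil, rfl⟩
  | .node [x], h => by
    rw [PTree.validDeg] at h
    simp at h
  | .node [x, y], h => by
    rw [PTree.validDeg] at h
    obtain ⟨bx, hx⟩ := exists_toP x (h.2 x (by simp))
    obtain ⟨b, hy⟩ := exists_toP y (h.2 y (by simp))
    exact ⟨.node () bx b, by simp [toP, hx, hy]⟩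
  | .node (x :: y :: z :: l), h => by
    rw [PTree.validDeg] at h
    simp at h

/-- Power sums of the total height. -/
def S (k n : ℕ) : ℝ := ∑ t ∈ treesOfNumNodesEq n, (ht t : ℝ) ^ k

theorem sum_T (T : Finset PTree) (n : ℕ)
    (hT : ∀ t : PTree, t ∈ T ↔ t.size = 2 * n + 1 ∧ t.validDeg {2}) (f : ℝ → ℝ) :
    ∑ t ∈ T, f (t.totalHeight : ℝ) = ∑ t ∈ treesOfNumNodesEq n, f (ht t : ℝ) := by
  symm
  refine Finset.sum_bij (fun t _ => toP t) ?_ ?_ ?_ ?_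
  · intro t ht
    rw [hT]
    rw [mem_treesOfNumNodesEq] at ht
    exact ⟨by rw [size_toP, ht], valid_toP t⟩
  · intro a _ b _ h
    exact toP_inj h
  · intro t ht
    rw [hT] at ht
    obtain ⟨b, rfl⟩ := exists_toP t ht.2
    refine ⟨b, ?_, rfl⟩
    rw [mem_treesOfNumNodesEq]
    have := ht.1
    rw [size_toP] at this
    omega
  · intro t _
    rw [height_toP]

theorem card_T (T : Finset PTree) (n : ℕ)
    (hT : ∀ t : PTree, t ∈ T ↔ t.size = 2 * n + 1 ∧ t.validDeg {2}) :
    (T.card : ℝ) = S 0 n := by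
  have := sum_T T n hT (fun _ => 1)
  simp [S] at this ⊢
  exact this

theorem S_zero (n : ℕ) : S 0 n = catalan n := by
  simp [S, treesOfNumNodesEq_card_eq_catalan]

theorem sum_trees_succ (n : ℕ) (f : BinaryTree Unit → ℝ) :
    ∑ t ∈ treesOfNumNodesEq (n + 1), f t =
      ∑ ij ∈ antidiagonal n, ∑ l ∈ treesOfNumNodesEq ij.1, ∑ r ∈ treesOfNumNodesEq ij.2,
        f (.node () l r) := by
  rw [treesOfNumNodesEq_succ, sum_biUnion]
  · apply sum_congr rfl
    rintro ⟨i, j⟩ H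
    rw [sum_map, sum_product]
    rfl
  · simp_rw [Set.PairwiseDisjoint, Set.Pairwise, disjoint_left]
    aesop

/-- Convolution power sums. -/
def Q (j n : ℕ) : ℝ := ∑ a ∈ range (j + 1), ∑ p ∈ antidiagonal n,
  (j.choose a : ℝ) * (S a p.1 * S (j - a) p.2)

theorem Q_eq (j n : ℕ) : Q j n = ∑ ij ∈ antidiagonal n, ∑ l ∈ treesOfNumNodesEq ij.1,
    ∑ r ∈ treesOfNumNodesEq ij.2, ((ht l : ℝ) + ht r) ^ j := by
  rw [Q, sum_comm]
  refine sum_congr rfl fun p _ => ?_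
  simp_rw [add_pow]
  simp_rw [S, sum_mul_sum, mul_sum]
  rw [sum_comm]
  refine Finset.sum_congr rfl fun l _ => ?_
  rw [sum_comm]
  refine Finset.sum_congr rfl fun r _ => ?_
  refine sum_congr rfl fun a _ => ?_
  ring

theorem S_succ (k n : ℕ) : S k (n + 1) =
    ∑ c ∈ range (k + 1), (k.choose c : ℝ) * ((2 * ((n : ℝ) + 1)) ^ c * Q (k - c) n) := by
  rw [S, sum_trees_succ]
  simp_rw [Q_eq, mul_sum]
  symm
  rw [sum_comm]
  refine sum_congr rfl fun p hp => ?_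
  rw [sum_comm]
  refine sum_congr rfl fun l hl => ?_
  rw [sum_comm]
  refine sum_congr rfl fun r hr => ?_
  rw [mem_treesOfNumNodesEq] at hl hr
  rw [HasAntidiagonal.mem_antidiagonal] at hp
  have : (ht (.node () l r) : ℝ) = 2 * ((n : ℝ) + 1) + ((ht l : ℝ) + ht r) := by
    simp only [ht, hl, hr, hp]
    push_cast
    ring
  rw [this, add_pow]
  refine sum_congr rfl fun c _ => ?_
  ring

theorem S_zero' (k : ℕ) (hk : k ≠ 0) : S k 0 = 0 := by
  simp [S, ht, hk]

open PowerSeries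

/-- Generating function of the `k`-th power sums, by number of leaves. -/
noncomputable def G (k : ℕ) : PowerSeries ℝ := X * PowerSeries.mk (S k)

noncomputable def P (j : ℕ) : PowerSeries ℝ :=
  ∑ a ∈ range (j + 1), (j.choose a : ℝ) • (G a * G (j - a))

/-- The derivation `z d/dz`. -/
noncomputable def D : Derivation ℝ (PowerSeries ℝ) (PowerSeries ℝ) :=
  (X : PowerSeries ℝ) • PowerSeries.derivative ℝ

noncomputable def E : PowerSeries ℝ →ₗ[ℝ] PowerSeries ℝ :=
  (2 : ℝ) • ((D : PowerSeries ℝ →ₗ[ℝ] PowerSeries ℝ) - LinearMap.id)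

theorem D_apply (f : PowerSeries ℝ) : D f = X * PowerSeries.derivative ℝ f := rfl

theorem E_apply (f : PowerSeries ℝ) : E f = (2 : ℝ) • (D f - f) := rfl

theorem coeff_D (n : ℕ) (f : PowerSeries ℝ) : coeff n (D f) = n * coeff n f := by
  rw [D_apply]
  cases n with
  | zero => simp
  | succ n =>
    rw [coeff_succ_X_mul, coeff_derivative]
    push_cast
    ring

theorem coeff_E (n : ℕ) (f : PowerSeries ℝ) :
    coeff n (E f) = (2 * ((n : ℝ) - 1)) * coeff n f := by
  rw [E_apply, coeff_smul, map_sub, coeff_D, smul_eq_mul]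
  ring

theorem coeff_E_pow (c n : ℕ) (f : PowerSeries ℝ) :
    coeff n ((E ^ c) f) = (2 * ((n : ℝ) - 1)) ^ c * coeff n f := by
  induction c with
  | zero => simp
  | succ c ih =>
    rw [pow_succ', Module.End.mul_apply, coeff_E, ih]
    ring

theorem P_eq (j : ℕ) : P j = X ^ 2 * PowerSeries.mk (Q j) := by
  have : PowerSeries.mk (Q j) = ∑ a ∈ range (j + 1), (j.choose a : ℝ) •
      (PowerSeries.mk (S a) * PowerSeries.mk (S (j - a))) := by
    ext n
    simp only [coeff_mk, Q, map_sum, coeff_smul, coeff_mul, smul_eq_mul, mul_sum]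
  rw [this, P, mul_sum]
  refine sum_congr rfl fun a _ => ?_
  rw [G, G, mul_smul_comm]
  congr 1
  ring

theorem coeff_P_zero (j : ℕ) : coeff 0 (P j) = 0 := by
  rw [P_eq, coeff_X_pow_mul']; simp

theorem coeff_P_one (j : ℕ) : coeff 1 (P j) = 0 := by
  rw [P_eq, coeff_X_pow_mul']; simp

theorem coeff_P (j n : ℕ) : coeff (n + 2) (P j) = Q j n := by
  rw [P_eq, coeff_X_pow_mul, coeff_mk]

theorem coeff_G (k n : ℕ) : coeff (n + 1) (G k) = S k n := by
  rw [G, coeff_succ_X_mul, coeff_mk]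

theorem coeff_G_zero (k : ℕ) : coeff 0 (G k) = 0 := by
  simp [G]

theorem G_rec (k : ℕ) (hk : k ≠ 0) :
    G k = ∑ c ∈ range (k + 1), (k.choose c : ℝ) • (E ^ c) (P (k - c)) := by
  ext n
  simp only [map_sum, coeff_smul, coeff_E_pow, smul_eq_mul]
  match n with
  | 0 => simp [coeff_G_zero, coeff_P_zero, -coeff_zero_eq_constantCoeff]
  | 1 => simp [coeff_G, coeff_P_one, S_zero' k hk]
  | n + 2 =>
    rw [coeff_G, S_succ]
    refine sum_congr rfl fun c _ => ?_
    rw [coeff_P]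
    push_cast
    ring

theorem G_zero_rec : G 0 = X + G 0 * G 0 := by
  have hP : P 0 = G 0 * G 0 := by simp [P]
  rw [← hP]
  ext n
  match n with
  | 0 => rw [map_add, coeff_G_zero, coeff_P_zero, coeff_zero_X, add_zero]
  | 1 => rw [map_add, coeff_G, coeff_P_one, coeff_one_X, S_zero]; simp
  | n + 2 =>
    rw [map_add, coeff_G, coeff_P, coeff_X, S_succ]
    simp

noncomputable def w : PowerSeries ℝ := 1 - 2 * G 0

theorem w_sq : w * w = 1 - 4 * X := by
  have := G_zero_rec
  rw [w]
  linear_combination (-4 : PowerSeries ℝ) * this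

theorem w_const : constantCoeff w = 1 := by
  simp [w, G]

noncomputable def u : (PowerSeries ℝ)ˣ :=
  Units.mk w w⁻¹ (PowerSeries.mul_inv_cancel w (by rw [w_const]; norm_num))
    (PowerSeries.inv_mul_cancel w (by rw [w_const]; norm_num))

/-- Powers of `(1 - 4 X)^(-1/2)`. -/
noncomputable def sp (j : ℤ) : PowerSeries ℝ := ((u⁻¹ ^ j : (PowerSeries ℝ)ˣ) : PowerSeries ℝ)

theorem sp_add (i j : ℤ) : sp (i + j) = sp i * sp j := by
  simp [sp, zpow_add]

theorem sp_zero : sp 0 = 1 := by simp [sp]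

theorem sp_neg_one : sp (-1) = w := by simp [sp, u]

theorem sp_one_mul_w : sp 1 * w = 1 := by
  rw [← sp_neg_one, ← sp_add]
  exact sp_zero

theorem sp_neg_two : sp (-2) = 1 - 4 * X := by
  rw [show (-2 : ℤ) = -1 + -1 by norm_num, sp_add, sp_neg_one, w_sq]

theorem D_w : D w = (-1 / 2 : ℝ) • (sp 1 - w) := by
  have h1 : D (w * w) = -4 * X := by
    rw [w_sq, D_apply]
    have : (4 * X : PowerSeries ℝ) = (4 : ℝ) • X := by
      rw [Algebra.smul_def, map_ofNat]
    rw [this, map_sub, Derivation.map_smul, derivative_X]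
    rw [derivative_one, Algebra.smul_def, map_ofNat]
    ring
  rw [Derivation.leibniz] at h1
  have h2 : (2 : PowerSeries ℝ) * D w = -4 * X * sp 1 := by
    simp only [smul_eq_mul] at h1
    linear_combination sp 1 * h1 - 2 * D w * sp_one_mul_w
  have h3 : (4 : PowerSeries ℝ) * D w = - 2 * (sp 1 - w) := by
    linear_combination 2 * h2 - 2 * sp 1 * w_sq + 2 * w * sp_one_mul_w
  have h4 : (4 : ℝ) • D w = (-2 : ℝ) • (sp 1 - w) := by
    rw [Algebra.smul_def, Algebra.smul_def]
    rw [map_neg, map_ofNat, map_ofNat]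
    exact h3
  have h5 : D w = (1 / 4 : ℝ) • ((4 : ℝ) • D w) := by rw [smul_smul]; norm_num
  rw [h5, h4, smul_smul]
  norm_num

theorem D_sp_add (i j : ℤ) (hi : D (sp i) = ((i : ℝ) / 2) • (sp (i + 2) - sp i))
    (hj : D (sp j) = ((j : ℝ) / 2) • (sp (j + 2) - sp j)) :
    D (sp (i + j)) = (((i + j : ℤ) : ℝ) / 2) • (sp (i + j + 2) - sp (i + j)) := by
  rw [sp_add, Derivation.leibniz, hi, hj, sp_add (i + j), sp_add i j, sp_add i 2, sp_add j 2]
  simp only [Algebra.smul_def, Algebra.algebraMap_self, RingHom.id_apply, Int.cast_add, add_div,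
    map_add]
  ring

theorem D_sp_neg (j : ℤ) (hj : D (sp j) = ((j : ℝ) / 2) • (sp (j + 2) - sp j)) :
    D (sp (-j)) = (((-j : ℤ) : ℝ) / 2) • (sp (-j + 2) - sp (-j)) := by
  have h0 : sp j * sp (-j) = 1 := by rw [← sp_add, add_neg_cancel, sp_zero]
  have h1 : D (sp j * sp (-j)) = 0 := by rw [h0]; simp
  rw [Derivation.leibniz, hj] at h1
  rw [sp_add j 2] at h1
  rw [sp_add (-j) 2]
  simp only [Algebra.smul_def, Algebra.algebraMap_self, RingHom.id_apply, Int.cast_neg, neg_div,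
    map_neg] at h1 ⊢
  set q := (algebraMap ℝ (PowerSeries ℝ)) ((j : ℝ) / 2)
  linear_combination sp (-j) * h1 - (D (sp (-j)) + sp (-j) * q * (sp 2 - 1)) * h0

theorem D_sp (j : ℤ) : D (sp j) = ((j : ℝ) / 2) • (sp (j + 2) - sp j) := by
  have hm : D (sp (-1)) = (((-1 : ℤ) : ℝ) / 2) • (sp (-1 + 2) - sp (-1)) := by
    rw [sp_neg_one, D_w]
    norm_num
  have hp : D (sp 1) = (((1 : ℤ) : ℝ) / 2) • (sp (1 + 2) - sp 1) := by
    have := D_sp_neg (-1) hm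
    simpa using this
  induction j using Int.induction_on with
  | zero => rw [sp_zero]; simp
  | succ i ih => exact D_sp_add _ _ ih hp
  | pred i ih => exact D_sp_add _ _ ih hm

/-- The filtration by order of growth. -/
noncomputable def L (m : ℤ) : Submodule ℝ (PowerSeries ℝ) := Submodule.span ℝ (Set.image sp (Set.Iic m))

theorem sp_mem {j m : ℤ} (h : j ≤ m) : sp j ∈ L m :=
  Submodule.subset_span ⟨j, h, rfl⟩

theorem L_mono {a b : ℤ} (h : a ≤ b) {f : PowerSeries ℝ} (hf : f ∈ L a) : f ∈ L b :=
  Submodule.span_mono (Set.image_mono (Set.Iic_subset_Iic.mpr h)) hf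

theorem L_mul {a b : ℤ} {f g : PowerSeries ℝ} (hf : f ∈ L a) (hg : g ∈ L b) :
    f * g ∈ L (a + b) := by
  have h := Submodule.mul_mem_mul hf hg
  rw [L, L, Submodule.span_mul_span] at h
  refine Submodule.span_mono ?_ h
  rintro _ ⟨_, ⟨i, hi, rfl⟩, _, ⟨j, hj, rfl⟩, rfl⟩
  exact ⟨i + j, Set.mem_Iic.mpr (add_le_add (Set.mem_Iic.mp hi) (Set.mem_Iic.mp hj)), sp_add i j⟩

theorem L_D {a : ℤ} {f : PowerSeries ℝ} (hf : f ∈ L a) : D f ∈ L (a + 2) := by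
  have : L a ≤ (L (a + 2)).comap (D : PowerSeries ℝ →ₗ[ℝ] PowerSeries ℝ) := by
    rw [L, Submodule.span_le]
    rintro _ ⟨i, hi, rfl⟩
    have hi' : i ≤ a := hi
    change D (sp i) ∈ L (a + 2)
    rw [D_sp]
    exact Submodule.smul_mem _ _ (Submodule.sub_mem _ (sp_mem (by omega)) (sp_mem (by omega)))
  exact this hf

theorem L_E {a : ℤ} {f : PowerSeries ℝ} (hf : f ∈ L a) : E f ∈ L (a + 2) := by
  rw [E_apply]
  exact Submodule.smul_mem _ _ (Submodule.sub_mem _ (L_D hf) (L_mono (by omega) hf))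

theorem L_E_pow {a : ℤ} {f : PowerSeries ℝ} (c : ℕ) (hf : f ∈ L a) : (E ^ c) f ∈ L (a + 2 * c) := by
  induction c with
  | zero => simpa using hf
  | succ c ih =>
    rw [pow_succ', Module.End.mul_apply]
    exact L_mono (by push_cast; omega) (L_E ih)

/-- `f` has leading term `c s^m`. -/
def Lead (c : ℝ) (m : ℤ) (f : PowerSeries ℝ) : Prop := f - c • sp m ∈ L (m - 1)

theorem Lead.mem {c : ℝ} {m : ℤ} {f : PowerSeries ℝ} (h : Lead c m f) : f ∈ L m := by
  have : f = (f - c • sp m) + c • sp m := by simp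
  rw [this]
  exact Submodule.add_mem _ (L_mono (by omega) h) (Submodule.smul_mem _ _ (sp_mem le_rfl))

theorem Lead.add {c d : ℝ} {m : ℤ} {f g : PowerSeries ℝ} (hf : Lead c m f) (hg : Lead d m g) :
    Lead (c + d) m (f + g) := by
  have := Submodule.add_mem _ hf hg
  unfold Lead
  convert this using 1
  module

theorem Lead.smul {c : ℝ} (r : ℝ) {m : ℤ} {f : PowerSeries ℝ} (hf : Lead c m f) :
    Lead (r * c) m (r • f) := by
  have := Submodule.smul_mem _ r hf
  unfold Lead
  convert this using 1
  module

theorem Lead.sum {ι : Type*} (s : Finset ι) {c : ι → ℝ} {m : ℤ} {f : ι → PowerSeries ℝ}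
    (hf : ∀ i ∈ s, Lead (c i) m (f i)) : Lead (∑ i ∈ s, c i) m (∑ i ∈ s, f i) := by
  unfold Lead
  rw [sum_smul, ← sum_sub_distrib]
  exact Submodule.sum_mem _ hf

theorem Lead.of_mem {m : ℤ} {f : PowerSeries ℝ} (hf : f ∈ L (m - 1)) : Lead 0 m f := by
  simpa [Lead] using hf

theorem Lead.mul {c d : ℝ} {m n : ℤ} {f g : PowerSeries ℝ} (hf : Lead c m f) (hg : Lead d n g) :
    Lead (c * d) (m + n) (f * g) := by
  have h1 := L_mul hf hg.mem
  have h2 := L_mul (Submodule.smul_mem _ c (sp_mem (le_refl m))) hg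
  have := Submodule.add_mem _ (L_mono (b := m + n - 1) (by omega) h1)
    (L_mono (b := m + n - 1) (by omega) h2)
  unfold Lead
  convert this using 1
  rw [sp_add]
  simp only [Algebra.smul_def, map_mul]
  ring

theorem Lead.E {c : ℝ} {m : ℤ} {f : PowerSeries ℝ} (hf : Lead c m f) :
    Lead (c * m) (m + 2) (E f) := by
  have h1 := L_E hf
  have h2 : TH.E (c • sp m) - (c * m) • sp (m + 2) ∈ L (m + 2 - 1) := by
    rw [E_apply, Derivation.map_smul, D_sp]
    have : (2 : ℝ) • (c • ((m : ℝ) / 2) • (sp (m + 2) - sp m) - c • sp m) - (c * m) • sp (m + 2)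
        = (-(c * m) - 2 * c) • sp m := by module
    rw [this]
    exact Submodule.smul_mem _ _ (sp_mem (by omega))
  have := Submodule.add_mem _ (L_mono (b := m + 2 - 1) (by omega) h1) h2
  unfold Lead
  convert this using 1
  rw [map_sub]
  abel

theorem X_mem : (X : PowerSeries ℝ) ∈ L 0 := by
  have h : (X : PowerSeries ℝ) = (1 / 4 : ℝ) • (sp 0 - sp (-2)) := by
    rw [sp_neg_two, sp_zero, Algebra.smul_def]
    have h4 : (4 : PowerSeries ℝ) = algebraMap ℝ _ 4 := (map_ofNat _ 4).symm
    rw [h4, sub_sub_cancel, ← mul_assoc, ← map_mul]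
    norm_num
  rw [h]
  exact Submodule.smul_mem _ _ (Submodule.sub_mem _ (sp_mem (by omega)) (sp_mem (by omega)))

theorem G_zero_eq : G 0 = (1 / 2 : ℝ) • (sp 0 - sp (-1)) := by
  rw [sp_zero, sp_neg_one, w, Algebra.smul_def]
  have h4 : (2 : PowerSeries ℝ) = algebraMap ℝ _ 2 := (map_ofNat _ 2).symm
  rw [h4, sub_sub_cancel, ← mul_assoc, ← map_mul]
  norm_num

theorem P_split (j : ℕ) (hj : j ≠ 0) :
    P j = (2 : ℝ) • (G 0 * G j) + ∑ a ∈ Ioo 0 j, (j.choose a : ℝ) • (G a * G (j - a)) := by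
  obtain ⟨i, rfl⟩ : ∃ i, j = i + 1 := ⟨j - 1, by omega⟩
  rw [P, sum_range_succ, ← Nat.Ico_zero_eq_range, sum_eq_sum_Ico_succ_bot (by omega)]
  have : Ico (0 + 1) (i + 1) = Ioo 0 (i + 1) := by ext; simp; omega
  rw [this]
  simp only [Nat.choose_zero_right, Nat.choose_self, Nat.cast_one, one_smul, Nat.sub_zero, Nat.sub_self,
    two_smul]
  ring

theorem G_solve (k : ℕ) (hk : k ≠ 0) :
    G k = sp 1 * (∑ a ∈ Ioo 0 k, (k.choose a : ℝ) • (G a * G (k - a)) +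
      ∑ c ∈ Ioc 0 k, (k.choose c : ℝ) • (E ^ c) (P (k - c))) := by
  have h := G_rec k hk
  rw [← Nat.Ico_zero_eq_range, sum_eq_sum_Ico_succ_bot (by omega)] at h
  have h2 : Ico (0 + 1) (k + 1) = Ioc 0 k := by ext; simp; omega
  rw [h2, Nat.choose_zero_right, Nat.cast_one, one_smul, pow_zero, Module.End.one_apply, Nat.sub_zero,
    P_split k hk, two_smul] at h
  have h3 := sp_one_mul_w
  rw [w] at h3
  linear_combination sp 1 * h - G k * h3

/-- Leading coefficients. -/
noncomputable def lc : ℕ → ℝ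
  | 0 => 0
  | 1 => 1 / 2
  | k + 2 => ∑ a : Fin (k + 1), ((k + 2).choose (a + 1) : ℝ) * (lc (a + 1) * lc (k + 1 - a))
      + (k + 2) * (3 * k + 2) * lc (k + 1)

theorem lc_rec (k : ℕ) (hk : 2 ≤ k) : lc k = ∑ a ∈ Ioo 0 k, (k.choose a : ℝ) * (lc a * lc (k - a)) +
    k * (lc (k - 1) * (3 * (k : ℝ) - 4)) := by
  obtain ⟨i, rfl⟩ : ∃ i, k = i + 2 := ⟨k - 2, by omega⟩
  rw [lc]
  congr 1
  · rw [Fin.sum_univ_eq_sum_range (fun a => ((i + 2).choose (a + 1) : ℝ) * (lc (a + 1) * lc (i + 1 - a)))]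
    have : Ioo 0 (i + 2) = Ico (0 + 1) (i + 1 + 1) := by ext; simp; omega
    rw [this, ← sum_Ico_add', Nat.Ico_zero_eq_range]
    refine sum_congr rfl fun a _ => ?_
    rw [show i + 2 - (a + 1) = i + 1 - a by omega]
  · push_cast
    ring

theorem E_P_zero : Lead (1 / 2) 1 (E (P 0)) := by
  have hP : P 0 = G 0 - X := by
    have hP : P 0 = G 0 * G 0 := by simp [P]
    rw [hP]
    linear_combination -G_zero_rec
  have hX : (X : PowerSeries ℝ) = (1 / 4 : ℝ) • (sp 0 - sp (-2)) := by
    rw [sp_neg_two, sp_zero, Algebra.smul_def]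
    have h4 : (4 : PowerSeries ℝ) = algebraMap ℝ _ 4 := (map_ofNat _ 4).symm
    rw [h4, sub_sub_cancel, ← mul_assoc, ← map_mul]
    norm_num
  have : P 0 = (1 / 4 : ℝ) • sp 0 + ((-1 / 2 : ℝ) • sp (-1) + (1 / 4 : ℝ) • sp (-2)) := by
    rw [hP, G_zero_eq, hX]
    module
  rw [this, map_add, map_add]
  have h0 : E ((1 / 4 : ℝ) • sp 0) ∈ L (1 - 1) := by
    rw [map_smul, E_apply, sp_zero]
    simp only [Derivation.map_one_eq_zero, zero_sub]
    rw [← sp_zero]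
    exact Submodule.smul_mem _ _ (Submodule.smul_mem _ _ (Submodule.neg_mem _ (sp_mem (by omega))))
  have h1 : Lead (1 / 2) 1 (E ((-1 / 2 : ℝ) • sp (-1))) := by
    have : Lead (-1 / 2) (-1) ((-1 / 2 : ℝ) • sp (-1)) := by simp [Lead]
    have := this.E
    norm_num at this ⊢
    exact this
  have h2 : E ((1 / 4 : ℝ) • sp (-2)) ∈ L (1 - 1) := by
    have := L_E (Submodule.smul_mem _ (1 / 4 : ℝ) (sp_mem (le_refl (-2))))
    simpa using this
  have := (Lead.of_mem h0).add (h1.add (Lead.of_mem h2))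
  simpa using this

theorem P_lead (j : ℕ) (hj : j ≠ 0) (h : ∀ i ≤ j, i ≠ 0 → Lead (lc i) (3 * i - 1) (G i)) :
    Lead (lc j) (3 * j - 1) (P j) := by
  rw [P_split j hj]
  have h1 : (2 : ℝ) • (G 0 * G j) = G j - sp (-1) * G j := by
    rw [G_zero_eq, Algebra.smul_mul_assoc, smul_smul, sp_zero]
    norm_num
    ring
  have h2 : -(sp (-1) * G j) + ∑ a ∈ Ioo 0 j, (j.choose a : ℝ) • (G a * G (j - a))
      ∈ L (3 * j - 1 - 1) := by
    refine Submodule.add_mem _ (Submodule.neg_mem _ ?_) (Submodule.sum_mem _ fun a ha => ?_)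
    · exact L_mono (by omega) (L_mul (sp_mem (le_refl (-1))) (h j le_rfl hj).mem)
    · rw [mem_Ioo] at ha
      refine Submodule.smul_mem _ _ (L_mono ?_ (L_mul (h a (by omega) (by omega)).mem
        (h (j - a) (by omega) (by omega)).mem))
      omega
  rw [h1, sub_eq_add_neg (G j), add_assoc]
  simpa using (h j le_rfl hj).add (Lead.of_mem h2)

theorem G_lead (k : ℕ) (hk : k ≠ 0) : Lead (lc k) (3 * k - 1) (G k) := by
  induction k using Nat.strong_induction_on with
  | _ k ih =>
  rw [G_solve k hk]
  have hs : Lead 1 1 (sp 1) := by simp [Lead]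
  rcases Nat.lt_or_ge k 2 with h1 | h2
  · obtain rfl : k = 1 := by omega
    have e1 : Ioo 0 1 = (∅ : Finset ℕ) := by decide
    have e2 : Ioc 0 1 = ({1} : Finset ℕ) := by decide
    rw [e1, e2, sum_empty, sum_singleton]
    simp only [zero_add, Nat.choose_self, Nat.cast_one, one_smul, pow_one, Nat.sub_self]
    have := hs.mul E_P_zero
    simpa [lc] using this
  · have hA : Lead (∑ a ∈ Ioo 0 k, (k.choose a : ℝ) * (lc a * lc (k - a))) (3 * k - 2)
        (∑ a ∈ Ioo 0 k, (k.choose a : ℝ) • (G a * G (k - a))) := by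
      refine Lead.sum _ fun a ha => ?_
      rw [mem_Ioo] at ha
      have := (ih a (by omega) (by omega)).mul (ih (k - a) (by omega) (by omega))
      have e : (3 * (a : ℤ) - 1 + (3 * ((k - a : ℕ) : ℤ) - 1)) = 3 * k - 2 := by omega
      rw [e] at this
      exact this.smul _
    have hB : Lead (k * (lc (k - 1) * (3 * (k : ℝ) - 4))) (3 * k - 2)
        (∑ c ∈ Ioc 0 k, (k.choose c : ℝ) • (E ^ c) (P (k - c))) := by
      have e2 : Ioc 0 k = insert 1 (Ioc 1 k) := by ext; simp; omega
      rw [e2, sum_insert (by simp)]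
      have hP := fun j (hj : j ≠ 0) (hjk : j < k) =>
        P_lead j hj (fun i hi hi0 => ih i (by omega) hi0)
      have t1 := ((hP (k - 1) (by omega) (by omega)).E).smul (k : ℝ)
      have e3 : 3 * ((k - 1 : ℕ) : ℤ) - 1 = 3 * k - 4 := by omega
      rw [e3] at t1
      have e4 : 3 * (k : ℤ) - 4 + 2 = 3 * k - 2 := by omega
      rw [e4] at t1
      have t2 : ∑ c ∈ Ioc 1 k, (k.choose c : ℝ) • (E ^ c) (P (k - c)) ∈ L (3 * k - 2 - 1) := by
        refine Submodule.sum_mem _ fun c hc => Submodule.smul_mem _ _ ?_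
        rw [mem_Ioc] at hc
        rcases hc.2.lt_or_eq with hlt | rfl
        · refine L_mono ?_ (L_E_pow c (hP (k - c) (by omega) (by omega)).mem)
          omega
        · obtain ⟨d, rfl⟩ : ∃ d, c = d + 1 := ⟨c - 1, by omega⟩
          rw [Nat.sub_self, pow_succ, Module.End.mul_apply]
          refine L_mono ?_ (L_E_pow d E_P_zero.mem)
          push_cast
          omega
      have := t1.add (Lead.of_mem t2)
      simpa using this
    have := hs.mul (hA.add hB)
    rw [← lc_rec k h2] at this
    have e : 1 + (3 * (k : ℤ) - 2) = 3 * k - 1 := by omega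
    rw [e] at this
    simpa using this

open Filter Topology

/-- Normalized coefficients. -/
noncomputable def nc (f : PowerSeries ℝ) (n : ℕ) : ℝ := coeff n f / 4 ^ n

theorem nc_step (j : ℤ) (hj : j ≠ 0) (n : ℕ) :
    nc (sp (j + 2)) n = nc (sp j) n * (1 + 2 * n / j) := by
  have h := congrArg (coeff n) (D_sp j)
  rw [coeff_D, coeff_smul, map_sub, smul_eq_mul] at h
  have hj' : (j : ℝ) ≠ 0 := by exact_mod_cast hj
  have h2 : coeff n (sp (j + 2)) = coeff n (sp j) * (1 + 2 * n / j) := by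
    field_simp
    linear_combination -2 * h
  rw [nc, nc, h2]
  ring

theorem nc_down (j : ℤ) (n : ℕ) :
    nc (sp (j - 2)) (n + 1) = nc (sp j) (n + 1) - nc (sp j) n := by
  have h : sp (j - 2) = sp j - X * ((4 : ℝ) • sp j) := by
    rw [sub_eq_add_neg, sp_add, sp_neg_two, Algebra.smul_def, map_ofNat]
    ring
  rw [nc, nc, nc, h, map_sub, coeff_succ_X_mul, coeff_smul, smul_eq_mul, pow_succ]
  field_simp

theorem nc_zero (n : ℕ) : nc (sp 0) (n + 1) = 0 := by
  rw [sp_zero, nc, coeff_one]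
  simp

theorem nc_two (n : ℕ) : nc (sp 2) n = 1 := by
  induction n with
  | zero =>
    have h : sp 2 * sp (-2) = 1 := by rw [← sp_add]; exact sp_zero
    rw [sp_neg_two] at h
    have := congrArg (coeff 0) h
    rw [coeff_zero_eq_constantCoeff, map_mul] at this
    simp at this
    simp [nc, this]
  | succ n ih =>
    have h := nc_down 2 n
    rw [sub_self, nc_zero, ih] at h
    linarith

theorem nc_one (n : ℕ) : nc (sp 1) n = n.centralBinom / 4 ^ n := by
  have h := nc_step (-1) (by norm_num) n
  rw [show (-1 + 2 : ℤ) = 1 by norm_num, sp_neg_one] at h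
  rw [h]
  rcases n with _ | n
  · have := w_const
    simp [nc, this]
  · have h1 : coeff (n + 1) w = -2 * catalan n := by
      have h2 : w = 1 - (2 : ℝ) • G 0 := by rw [w, Algebra.smul_def, map_ofNat]
      rw [h2, map_sub, coeff_smul, coeff_G, S_zero, coeff_one]
      simp
    rw [nc, h1]
    have h3 : ((n : ℝ) + 1) * catalan n = n.centralBinom := by
      exact_mod_cast succ_mul_catalan_eq_centralBinom n
    have h4 : ((n : ℝ) + 1) * (n + 1).centralBinom = 2 * (2 * n + 1) * n.centralBinom := by
      exact_mod_cast Nat.succ_mul_centralBinom_succ n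
    have h5 : ((n : ℝ) + 1) ≠ 0 := by positivity
    have h6 : ((n + 1).centralBinom : ℝ) = 2 * (2 * n + 1) * catalan n := by
      apply mul_left_cancel₀ h5
      rw [h4, ← h3]
      ring
    rw [h6]
    push_cast
    field_simp
    ring

theorem nc_one_lim :
    Tendsto (fun n : ℕ => nc (sp 1) n * (n : ℝ) ^ ((1 : ℝ) - ((1 : ℕ) : ℝ) / 2)) atTop
      (𝓝 (1 / √Real.pi)) := by
  have h1 : ∀ n : ℕ, nc (sp 1) n * (n : ℝ) ^ ((1 : ℝ) - ((1 : ℕ) : ℝ) / 2)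
      = √((n : ℝ) / (2 * n + 1) / Real.Wallis.W n) := by
    intro n
    have hW := Real.Wallis.W_eq_factorial_ratio n
    have hc : (n.centralBinom : ℝ) * ((n.factorial : ℝ) * n.factorial) = (2 * n).factorial := by
      have := Nat.choose_mul_factorial_mul_factorial (show n ≤ 2 * n by omega)
      rw [show 2 * n - n = n by omega, ← Nat.centralBinom_eq_two_mul_choose] at this
      rw [← mul_assoc]
      exact_mod_cast this
    have hf : (n.factorial : ℝ) ≠ 0 := by positivity
    have hcb : (n.centralBinom : ℝ) ≠ 0 := by exact_mod_cast n.centralBinom_ne_zero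
    have h2n : (2 * (n : ℝ) + 1) ≠ 0 := by positivity
    have key : (n : ℝ) / (2 * n + 1) / Real.Wallis.W n = (nc (sp 1) n) ^ 2 * n := by
      rw [hW, nc_one, ← hc]
      rw [show (2 : ℝ) ^ (4 * n) = (4 ^ n) ^ 2 by
        rw [← pow_mul, show (4 : ℝ) = 2 ^ 2 by norm_num, ← pow_mul]; congr 1; ring]
      field_simp
    rw [key, Real.sqrt_mul (sq_nonneg _), Real.sqrt_sq (by rw [nc_one]; positivity), Real.sqrt_eq_rpow]
    norm_num
  simp_rw [h1]
  have h2 : (1 : ℝ) / √Real.pi = √(1 / 2 / (Real.pi / 2)) := by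
    rw [show (1 : ℝ) / 2 / (Real.pi / 2) = Real.pi⁻¹ by field_simp, Real.sqrt_inv, one_div]
  rw [h2]
  refine (Real.continuous_sqrt.tendsto _).comp ?_
  exact Stirling.tendsto_self_div_two_mul_self_add_one.div Real.Wallis.tendsto_W_nhds_pi_div_two
    (by positivity)

/-- Limits of scaled coefficients. -/
noncomputable def ell : ℕ → ℝ
  | 0 => 0
  | 1 => 1 / √Real.pi
  | 2 => 1
  | j + 3 => ell (j + 1) * (2 / (j + 1))

theorem nc_lim : ∀ j : ℕ, 1 ≤ j →
    Tendsto (fun n : ℕ => nc (sp j) n * (n : ℝ) ^ ((1 : ℝ) - (j : ℝ) / 2)) atTop (𝓝 (ell j))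
  | 0, h => by omega
  | 1, _ => nc_one_lim
  | 2, _ => by
    have : ∀ n : ℕ, nc (sp (2 : ℕ)) n * (n : ℝ) ^ ((1 : ℝ) - ((2 : ℕ) : ℝ) / 2) = 1 := by
      intro n
      have := nc_two n
      norm_num
      exact this
    simp_rw [this]
    exact tendsto_const_nhds
  | j + 3, _ => by
    have ih := nc_lim (j + 1) (by omega)
    have h1 : Tendsto (fun n : ℕ => (1 / (n : ℝ)) + 2 / ((j : ℝ) + 1)) atTop
        (𝓝 (0 + 2 / ((j : ℝ) + 1))) :=
      tendsto_one_div_atTop_nhds_zero_nat.add tendsto_const_nhds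
    rw [zero_add] at h1
    refine (ih.mul h1).congr' ?_
    filter_upwards [eventually_gt_atTop 0] with n hn
    have hn' : (0 : ℝ) < n := by exact_mod_cast hn
    have hs := nc_step ((j + 1 : ℕ) : ℤ) (by omega) n
    have e : (((j + 1 : ℕ) : ℤ) + 2) = ((j + 3 : ℕ) : ℤ) := by push_cast; ring
    rw [e] at hs
    rw [hs]
    have e2 : (1 : ℝ) - ((j + 3 : ℕ) : ℝ) / 2 = (1 - ((j + 1 : ℕ) : ℝ) / 2) - 1 := by
      push_cast; ring
    rw [e2, Real.rpow_sub_one hn'.ne']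
    push_cast
    field_simp

theorem nc_small (m : ℕ) : Tendsto (fun n : ℕ => nc (sp (1 - m)) n) atTop (𝓝 0) := by
  induction m using Nat.strong_induction_on with
  | _ m ih =>
  match m with
  | 0 =>
    have h := nc_one_lim.mul ((tendsto_rpow_neg_atTop (show (0 : ℝ) < 1 / 2 by norm_num)).comp
      tendsto_natCast_atTop_atTop)
    rw [mul_zero] at h
    refine h.congr' ?_
    filter_upwards [eventually_gt_atTop 0] with n hn
    have hn' : (0 : ℝ) < n := by exact_mod_cast hn
    rw [Function.comp_apply, mul_assoc, ← Real.rpow_add hn']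
    norm_num
  | 1 =>
    refine tendsto_const_nhds.congr' ?_
    filter_upwards [eventually_gt_atTop 0] with n hn
    obtain ⟨i, rfl⟩ : ∃ i, n = i + 1 := ⟨n - 1, by omega⟩
    simp [nc_zero]
  | m + 2 =>
    have h := ih m (by omega)
    rw [← tendsto_add_atTop_iff_nat 1]
    have h2 := ((tendsto_add_atTop_iff_nat 1).mpr h).sub h
    rw [sub_zero] at h2
    refine h2.congr fun n => ?_
    rw [← nc_down]
    congr 2
    push_cast
    ring

theorem nc_little (m : ℕ) (hm : 2 ≤ m) (j : ℤ) (hj : j ≤ m - 1) :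
    Tendsto (fun n : ℕ => nc (sp j) n * (n : ℝ) ^ ((1 : ℝ) - (m : ℝ) / 2)) atTop (𝓝 0) := by
  rcases le_or_gt j 0 with h0 | h0
  · obtain ⟨i, rfl⟩ : ∃ i : ℕ, j = 1 - i := ⟨(1 - j).toNat, by omega⟩
    have h := nc_small i
    refine squeeze_zero_norm' ?_ (tendsto_norm_zero.comp h)
    filter_upwards [eventually_ge_atTop 1] with n hn
    have hn' : (1 : ℝ) ≤ n := by exact_mod_cast hn
    have hm' : (2 : ℝ) ≤ m := by exact_mod_cast hm
    rw [norm_mul, Function.comp_apply]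
    apply mul_le_of_le_one_right (norm_nonneg _)
    rw [Real.norm_of_nonneg (by positivity)]
    exact Real.rpow_le_one_of_one_le_of_nonpos hn' (by linarith)
  · obtain ⟨i, rfl⟩ : ∃ i : ℕ, j = i := ⟨j.toNat, by omega⟩
    have hlt : (i : ℝ) < m := by
      have : i < m := by omega
      exact_mod_cast this
    have h := (nc_lim i (by omega)).mul ((tendsto_rpow_neg_atTop
      (show (0 : ℝ) < ((m : ℝ) - i) / 2 by linarith)).comp tendsto_natCast_atTop_atTop)
    rw [mul_zero] at h
    refine h.congr' ?_
    filter_upwards [eventually_gt_atTop 0] with n hn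
    have hn' : (0 : ℝ) < n := by exact_mod_cast hn
    rw [Function.comp_apply, mul_assoc, ← Real.rpow_add hn']
    congr 2
    ring

theorem nc_add (f g : PowerSeries ℝ) (n : ℕ) : nc (f + g) n = nc f n + nc g n := by
  simp [nc, add_div]

theorem nc_smul (r : ℝ) (f : PowerSeries ℝ) (n : ℕ) : nc (r • f) n = r * nc f n := by
  simp [nc, mul_div_assoc]

theorem L_lim (m : ℕ) (hm : 2 ≤ m) (f : PowerSeries ℝ) (hf : f ∈ L (m - 1)) :
    Tendsto (fun n : ℕ => nc f n * (n : ℝ) ^ ((1 : ℝ) - (m : ℝ) / 2)) atTop (𝓝 0) := by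
  rw [L] at hf
  induction hf using Submodule.span_induction with
  | mem x hx =>
    obtain ⟨j, hj, rfl⟩ := hx
    exact nc_little m hm j hj
  | zero => simp [nc]
  | add x y _ _ hx hy =>
    have := hx.add hy
    rw [add_zero] at this
    refine this.congr fun n => ?_
    rw [nc_add]; ring
  | smul r x _ hx =>
    have := hx.const_mul r
    rw [mul_zero] at this
    refine this.congr fun n => ?_
    rw [nc_smul]; ring

theorem Lead.lim {c : ℝ} (m : ℕ) (hm : 2 ≤ m) {f : PowerSeries ℝ} (hf : Lead c m f) :
    Tendsto (fun n : ℕ => nc f n * (n : ℝ) ^ ((1 : ℝ) - (m : ℝ) / 2)) atTop (𝓝 (c * ell m)) := by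
  have h := (L_lim m hm _ hf).add ((nc_lim m (by omega)).const_mul c)
  rw [zero_add] at h
  refine h.congr fun n => ?_
  have : nc f n = nc (f - c • sp m) n + c * nc (sp m) n := by
    rw [← nc_smul, ← nc_add, sub_add_cancel]
  rw [this]
  ring

/-- Limits of scaled raw moments. -/
noncomputable def cc (k : ℕ) : ℝ := 4 * √Real.pi * (lc k * ell (3 * k - 1))

noncomputable def xs (n : ℕ) : ℝ := (n : ℝ) ^ (-(3 / 2) : ℝ)

theorem raw_lim (k : ℕ) (hk : k ≠ 0) :
    Tendsto (fun n : ℕ => S k n / S 0 n * xs n ^ k) atTop (𝓝 (cc k)) := by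
  have hG := G_lead k hk
  have e : (3 * (k : ℤ) - 1) = ((3 * k - 1 : ℕ) : ℤ) := by omega
  rw [e] at hG
  have h1 := (tendsto_add_atTop_iff_nat 1).mpr (hG.lim (3 * k - 1) (by omega))
  have hpi : √Real.pi ≠ 0 := (Real.sqrt_pos.mpr Real.pi_pos).ne'
  have h2 := nc_one_lim.inv₀ (by positivity)
  have h3 : Tendsto (fun n : ℕ => (((n : ℝ) + 1) / n) ^ (((3 * k - 1 : ℕ) : ℝ) / 2)) atTop (𝓝 1) := by
    have h4 : Tendsto (fun n : ℕ => ((n : ℝ) + 1) / n) atTop (𝓝 1) := by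
      have := (tendsto_one_div_atTop_nhds_zero_nat (𝕜 := ℝ)).const_add 1
      rw [add_zero] at this
      refine this.congr' ?_
      filter_upwards [eventually_gt_atTop 0] with n hn
      have hn' : (0 : ℝ) < n := by exact_mod_cast hn
      field_simp
    have := h4.rpow_const (p := ((3 * k - 1 : ℕ) : ℝ) / 2) (Or.inl one_ne_zero)
    rwa [Real.one_rpow] at this
  have h := ((h1.mul h2).mul h3).const_mul 4
  have hlim : 4 * (lc k * ell (3 * k - 1) * (1 / √Real.pi)⁻¹ * 1) = cc k := by
    rw [cc, one_div, inv_inv]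
    ring
  rw [hlim] at h
  refine h.congr' ?_
  filter_upwards [eventually_gt_atTop 0] with n hn
  have hn' : (0 : ℝ) < n := by exact_mod_cast hn
  have hn1 : (0 : ℝ) < (n : ℝ) + 1 := by positivity
  have hS : S k n = nc (G k) (n + 1) * 4 ^ (n + 1) := by
    rw [nc, coeff_G]
    field_simp
  have hC : S 0 n = nc (sp 1) n * 4 ^ n / (n + 1) := by
    rw [nc_one, S_zero]
    have h3 : ((n : ℝ) + 1) * catalan n = n.centralBinom := by
      exact_mod_cast succ_mul_catalan_eq_centralBinom n
    rw [← h3]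
    field_simp
  have hnz : nc (sp 1) n ≠ 0 := by
    rw [nc_one]
    have hcb : (n.centralBinom : ℝ) ≠ 0 := by exact_mod_cast n.centralBinom_ne_zero
    positivity
  have hk3 : ((3 * k - 1 : ℕ) : ℝ) = 3 * k - 1 := by
    rw [Nat.cast_sub (by omega)]
    push_cast; ring
  rw [hS, hC, xs, ← Real.rpow_mul_natCast hn'.le, hk3, Real.div_rpow hn1.le hn'.le]
  have e1 : ((n + 1 : ℕ) : ℝ) = (n : ℝ) + 1 := by push_cast; ring
  rw [e1, Real.rpow_sub hn1, Real.rpow_one]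
  have e2 : (n : ℝ) ^ (-(3 / 2) * (k : ℝ)) =
      ((n : ℝ) ^ ((1 : ℝ) - ((1 : ℕ) : ℝ) / 2) * (n : ℝ) ^ ((3 * (k : ℝ) - 1) / 2))⁻¹ := by
    rw [← Real.rpow_add hn', ← Real.rpow_neg hn'.le]
    congr 1
    push_cast; ring
  rw [e2]
  have p1 : (n : ℝ) ^ ((1 : ℝ) - ((1 : ℕ) : ℝ) / 2) ≠ 0 := (Real.rpow_pos_of_pos hn' _).ne'
  have p2 : (n : ℝ) ^ ((3 * (k : ℝ) - 1) / 2) ≠ 0 := (Real.rpow_pos_of_pos hn' _).ne'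
  have p3 : ((n : ℝ) + 1) ^ ((3 * (k : ℝ) - 1) / 2) ≠ 0 := (Real.rpow_pos_of_pos hn1 _).ne'
  generalize (n : ℝ) ^ ((1 : ℝ) - ((1 : ℕ) : ℝ) / 2) = q1 at *
  generalize (n : ℝ) ^ ((3 * (k : ℝ) - 1) / 2) = q2 at *
  generalize ((n : ℝ) + 1) ^ ((3 * (k : ℝ) - 1) / 2) = q3 at *
  rw [pow_succ]
  field_simp

/-- Limits of raw moments including the zeroth. -/
noncomputable def rr (k : ℕ) : ℝ := if k = 0 then 1 else cc k

theorem S_zero_pos (n : ℕ) : 0 < S 0 n := by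
  rw [S_zero]
  have h3 := succ_mul_catalan_eq_centralBinom n
  have h4 := n.centralBinom_pos
  have : 0 < catalan n := by
    rcases Nat.eq_zero_or_pos (catalan n) with h | h
    · rw [h] at h3; omega
    · exact h
  exact_mod_cast this

theorem raw_lim' (k : ℕ) :
    Tendsto (fun n : ℕ => S k n / S 0 n * xs n ^ k) atTop (𝓝 (rr k)) := by
  rcases eq_or_ne k 0 with rfl | hk
  · have : ∀ n : ℕ, S 0 n / S 0 n * xs n ^ 0 = 1 := fun n => by
      rw [div_self (S_zero_pos n).ne', pow_zero, one_mul]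
    simp_rw [this]
    simp [rr]
  · rw [rr, if_neg hk]
    exact raw_lim k hk

theorem central_lim (i : ℕ) :
    Tendsto (fun n : ℕ => (∑ t ∈ treesOfNumNodesEq n, ((ht t : ℝ) - S 1 n / S 0 n) ^ i) / S 0 n
      * xs n ^ i) atTop
      (𝓝 (∑ j ∈ range (i + 1), rr j * (-rr 1) ^ (i - j) * i.choose j)) := by
  have h : Tendsto (fun n : ℕ => ∑ j ∈ range (i + 1), (S j n / S 0 n * xs n ^ j) *
      (-(S 1 n / S 0 n * xs n ^ 1)) ^ (i - j) * i.choose j) atTop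
      (𝓝 (∑ j ∈ range (i + 1), rr j * (-rr 1) ^ (i - j) * i.choose j)) :=
    tendsto_finsetSum _ fun j _ =>
      ((raw_lim' j).mul ((raw_lim' 1).neg.pow (i - j))).mul_const _
  refine h.congr fun n => ?_
  simp_rw [sub_eq_add_neg, add_pow]
  rw [sum_comm, sum_div, sum_mul]
  refine sum_congr rfl fun j hj => ?_
  rw [mem_range] at hj
  rw [← sum_mul, ← sum_mul, ← S]
  obtain ⟨d, rfl⟩ : ∃ d, i = j + d := ⟨i - j, by omega⟩
  rw [Nat.add_sub_cancel_left, pow_one, neg_mul_eq_neg_mul, mul_pow, pow_add]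
  ring

theorem lc_vals : lc 1 = 1 / 2 ∧ lc 2 = 5 / 2 ∧ lc 3 = 45 ∧ lc 4 = 3315 / 2 ∧ lc 5 = 101700 ∧
    lc 6 = 18635625 / 2 := by
  have h1 : lc 1 = 1 / 2 := by rw [lc]
  have i2 : Ioo 0 2 = ({1} : Finset ℕ) := by decide
  have i3 : Ioo 0 3 = ({1, 2} : Finset ℕ) := by decide
  have i4 : Ioo 0 4 = ({1, 2, 3} : Finset ℕ) := by decide
  have i5 : Ioo 0 5 = ({1, 2, 3, 4} : Finset ℕ) := by decide
  have i6 : Ioo 0 6 = ({1, 2, 3, 4, 5} : Finset ℕ) := by decide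
  have h2 : lc 2 = 5 / 2 := by
    rw [lc_rec 2 (by norm_num), i2]; norm_num [h1]
  have h3 : lc 3 = 45 := by
    rw [lc_rec 3 (by norm_num), i3]; norm_num [h1, h2, Nat.choose]
  have h4 : lc 4 = 3315 / 2 := by
    rw [lc_rec 4 (by norm_num), i4]; norm_num [h1, h2, h3, Nat.choose]
  have h5 : lc 5 = 101700 := by
    rw [lc_rec 5 (by norm_num), i5]; norm_num [h1, h2, h3, h4, Nat.choose]
  have h6 : lc 6 = 18635625 / 2 := by
    rw [lc_rec 6 (by norm_num), i6]; norm_num [h1, h2, h3, h4, h5, Nat.choose]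
  exact ⟨h1, h2, h3, h4, h5, h6⟩

theorem rr_vals : rr 0 = 1 ∧ rr 1 = 2 * √Real.pi ∧ rr 2 = 40 / 3 ∧ rr 3 = 30 * √Real.pi ∧
    rr 4 = 14144 / 63 ∧ rr 5 = 565 * √Real.pi ∧ rr 6 = 42406400 / 9009 := by
  obtain ⟨h1, h2, h3, h4, h5, h6⟩ := lc_vals
  have hpi : √Real.pi ≠ 0 := (Real.sqrt_pos.mpr Real.pi_pos).ne'
  refine ⟨by simp [rr], ?_, ?_, ?_, ?_, ?_, ?_⟩
  · norm_num [rr, cc, h1, ell]; ring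
  · norm_num [rr, cc, h2, ell]; field_simp; norm_num
  · norm_num [rr, cc, h3, ell]; ring
  · norm_num [rr, cc, h4, ell]; field_simp; norm_num
  · norm_num [rr, cc, h5, ell]; ring
  · norm_num [rr, cc, h6, ell]; field_simp; norm_num

theorem sum_two : ∑ j ∈ range (2 + 1), rr j * (-rr 1) ^ (2 - j) * (Nat.choose 2 j : ℝ)
    = 4 / 3 * (10 - 3 * Real.pi) := by
  obtain ⟨h0, h1, h2, h3, h4, h5, h6⟩ := rr_vals
  have hs := Real.sq_sqrt Real.pi_pos.le
  simp only [sum_range_succ, sum_range_zero, h0, h1, h2]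
  norm_num [Nat.choose]
  linear_combination (-4) * hs

theorem sum_six : ∑ j ∈ range (6 + 1), rr j * (-rr 1) ^ (6 - j) * (Nat.choose 6 j : ℝ)
    = (4 / 3) ^ 3 * ((15 / 16016) * (-144144 * Real.pi ^ 3 - 720720 * Real.pi ^ 2 +
      3013725 * Real.pi + 2120320)) := by
  obtain ⟨h0, h1, h2, h3, h4, h5, h6⟩ := rr_vals
  have hs := Real.sq_sqrt Real.pi_pos.le
  simp only [sum_range_succ, sum_range_zero, h0, h1, h2, h3, h4, h5, h6]
  norm_num [Nat.choose]
  have e4 : √Real.pi ^ 4 = Real.pi ^ 2 := by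
    linear_combination (√Real.pi ^ 2 + Real.pi) * hs
  have e6 : √Real.pi ^ 6 = Real.pi ^ 3 := by
    linear_combination (√Real.pi ^ 4 + √Real.pi ^ 2 * Real.pi + Real.pi ^ 2) * hs
  ring_nf
  simp only [hs, e4, e6]

end TH

open Filter Real

/-- Let `H_n` be the total height (sum over all vertices of the distance to the root) on
complete binary trees with `2n+1` vertices, under the uniform distribution; with mean
`μ n`, central moments `m i n`, and scaled moments `α i n = m i n / (m 2 n)^(i/2)`,
the `6`-th scaled moment converges as `n → ∞` to the stated constant. -/
theorem totalheight_stmt10 (T : ℕ → Finset PTree)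
    (hT : ∀ n : ℕ, ∀ t : PTree, t ∈ T n ↔ t.size = 2 * n + 1 ∧ t.validDeg {2})
    (μ : ℕ → ℝ)
    (hμ : ∀ n : ℕ, μ n = (∑ t ∈ T n, (t.totalHeight : ℝ)) / ((T n).card : ℝ))
    (m : ℕ → ℕ → ℝ)
    (hm : ∀ i n : ℕ, m i n =
      (∑ t ∈ T n, ((t.totalHeight : ℝ) - μ n) ^ i) / ((T n).card : ℝ))
    (α : ℕ → ℕ → ℝ)
    (hα : ∀ i n : ℕ, α i n = m i n / (m 2 n) ^ ((i : ℝ) / 2)) :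
    Tendsto (fun n : ℕ => α 6 n) atTop
      (nhds ((15 / 16016) * (-144144 * π ^ 3 - 720720 * π ^ 2 + 3013725 * π + 2120320) / (10 - 3 * π) ^ 3)) := by
  have hS : ∀ k n : ℕ, ∑ t ∈ T n, (t.totalHeight : ℝ) ^ k = TH.S k n := fun k n =>
    TH.sum_T (T n) n (hT n) (fun x => x ^ k)
  have hcard : ∀ n, ((T n).card : ℝ) = TH.S 0 n := fun n => TH.card_T (T n) n (hT n)
  have hμ' : ∀ n, μ n = TH.S 1 n / TH.S 0 n := fun n => by
    rw [hμ, hcard, ← hS 1 n]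
    simp
  have hm' : ∀ i n, m i n = (∑ t ∈ BinaryTree.treesOfNumNodesEq n,
      ((TH.ht t : ℝ) - TH.S 1 n / TH.S 0 n) ^ i) / TH.S 0 n := fun i n => by
    rw [hm, hcard, hμ', TH.sum_T (T n) n (hT n) (fun x => (x - TH.S 1 n / TH.S 0 n) ^ i)]
  have h6 := TH.central_lim 6
  have h2 := TH.central_lim 2
  rw [TH.sum_six] at h6
  rw [TH.sum_two] at h2
  simp_rw [← hm'] at h6 h2
  have hpi : (0 : ℝ) < 10 - 3 * π := by
    have := Real.pi_lt_d2
    linarith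
  have h := h6.div (h2.pow 3) (by positivity)
  have e : (4 / 3) ^ 3 * ((15 / 16016) * (-144144 * π ^ 3 - 720720 * π ^ 2 + 3013725 * π + 2120320)) /
      (4 / 3 * (10 - 3 * π)) ^ 3 =
      (15 / 16016) * (-144144 * π ^ 3 - 720720 * π ^ 2 + 3013725 * π + 2120320) / (10 - 3 * π) ^ 3 := by
    rw [mul_pow, mul_div_mul_left _ _ (by norm_num)]
  rw [e] at h
  refine h.congr' ?_
  filter_upwards [eventually_gt_atTop 0] with n hn
  have hx : TH.xs n ≠ 0 := by
    have hn' : (0 : ℝ) < n := by exact_mod_cast hn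
    exact (Real.rpow_pos_of_pos hn' _).ne'
  have e3 : (((6 : ℕ) : ℝ) / 2) = ((3 : ℕ) : ℝ) := by norm_num
  rw [hα, e3, Real.rpow_natCast, Pi.div_apply]
  rw [mul_pow, ← pow_mul, mul_div_mul_right _ _ (pow_ne_zero _ hx)]
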